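/- arXiv:1605.01267 — 2 statements merged into one kernel-verified Lean document; each statement's English description precedes it below -/
import Mathlib

section
/- If x, y, z, w are orthonormal vectors in ℝ⁸, then τ(x,y,z,w) = 0 if and only if Φ₀(x,y,z,w) = 1 or Φ₀(x,y,z,w) = −1 (vanishing of τ characterizes Cayley 4-planes). -/
noncomputable section
open scoped RealInnerProductSpace

abbrev E8 := EuclideanSpace ℝ (Fin 8)

/-- `dxⁱ ∧ dxʲ ∧ dxᵏ ∧ dxˡ` evaluated on `(x, y, z, w)` (indices 0-based). -/
def d4 (i j k l : Fin 8) (x y z w : E8) : ℝ :=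
  Matrix.det !![x i, x j, x k, x l; y i, y j, y k, y l;
                z i, z j, z k, z l; w i, w j, w k, w l]

/-- The Cayley 4-form
`Φ₀ = dx¹²³⁴ + dx¹²⁵⁶ − dx¹²⁷⁸ + dx¹³⁵⁷ + dx¹³⁶⁸ + dx¹⁴⁵⁸ − dx¹⁴⁶⁷ − dx²³⁵⁸ + dx²³⁶⁷`
`  + dx²⁴⁵⁷ + dx²⁴⁶⁸ − dx³⁴⁵⁶ + dx³⁴⁷⁸ + dx⁵⁶⁷⁸` (1-based indices; here 0-based). -/
def Phi (x y z w : E8) : ℝ :=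
  d4 0 1 2 3 x y z w + d4 0 1 4 5 x y z w - d4 0 1 6 7 x y z w
    + d4 0 2 4 6 x y z w + d4 0 2 5 7 x y z w + d4 0 3 4 7 x y z w
    - d4 0 3 5 6 x y z w - d4 1 2 4 7 x y z w + d4 1 2 5 6 x y z w
    + d4 1 3 4 6 x y z w + d4 1 3 5 7 x y z w - d4 2 3 4 5 x y z w
    + d4 2 3 6 7 x y z w + d4 4 5 6 7 x y z w

/-- The Gram determinant `|x∧y∧z∧w|² = det(⟨vᵢ,vⱼ⟩)`. -/
def gram4 (x y z w : E8) : ℝ :=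
  Matrix.det !![⟪x, x⟫, ⟪x, y⟫, ⟪x, z⟫, ⟪x, w⟫;
                ⟪y, x⟫, ⟪y, y⟫, ⟪y, z⟫, ⟪y, w⟫;
                ⟪z, x⟫, ⟪z, y⟫, ⟪z, z⟫, ⟪z, w⟫;
                ⟪w, x⟫, ⟪w, y⟫, ⟪w, z⟫, ⟪w, w⟫]

/-- The standard orthonormal basis vector `eᵢ` of ℝ⁸. -/
def e₈ (i : Fin 8) : E8 := EuclideanSpace.single i 1

/-- `α : ℝ⁸ × ℝ⁸ → ℝ` is a 2-form: antisymmetric and bilinear. -/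
def IsForm2 (α : E8 → E8 → ℝ) : Prop :=
  (∀ a b, α b a = -α a b) ∧
  (∀ a a' b, α (a + a') b = α a b + α a' b) ∧
  (∀ (r : ℝ) a b, α (r • a) b = r * α a b)

/-- The inner product of 2-forms: `⟨α,β⟩ = Σ_{i<j} α(eᵢ,eⱼ) β(eᵢ,eⱼ)`. -/
def innerF2 (α β : E8 → E8 → ℝ) : ℝ :=
  ∑ i : Fin 8, ∑ j : Fin 8, if i < j then α (e₈ i) (e₈ j) * β (e₈ i) (e₈ j) else 0

/-- The volume form `vol = dx¹∧⋯∧dx⁸` evaluated on eight vectors. -/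
def vol8 (x : Fin 8 → E8) : ℝ :=
  Matrix.det (Matrix.of fun i j : Fin 8 => x i j)

/-- The 6-form `v♭ ∧ w♭ ∧ Φ₀` evaluated on six vectors
(`v♭ = ⟨v,·⟩`; the wedge of a 2-form with a 4-form via the shuffle/permutation formula). -/
def sixForm (v w : E8) (x : Fin 6 → E8) : ℝ :=
  (1 / 48 : ℝ) * ∑ σ : Equiv.Perm (Fin 6), ((Equiv.Perm.sign σ : ℤ) : ℝ) *
    ((⟪v, x (σ 0)⟫ * ⟪w, x (σ 1)⟫ - ⟪v, x (σ 1)⟫ * ⟪w, x (σ 0)⟫) *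
      Phi (x (σ 2)) (x (σ 3)) (x (σ 4)) (x (σ 5)))

/-- The 8-form `α ∧ β` for a 2-form `α` and a 6-form `β`, evaluated on eight vectors
(via the permutation formula, with the factor `1/(2!·6!) = 1/1440`). -/
def wedge26 (α : E8 → E8 → ℝ) (β : (Fin 6 → E8) → ℝ) (x : Fin 8 → E8) : ℝ :=
  (1 / 1440 : ℝ) * ∑ σ : Equiv.Perm (Fin 8), ((Equiv.Perm.sign σ : ℤ) : ℝ) *
    (α (x (σ 0)) (x (σ 1)) * β fun i : Fin 6 => x (σ ⟨i.1 + 2, by omega⟩))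

lemma sum_sign_zero (a b : Fin 8) (hab : a ≠ b) (F : Equiv.Perm (Fin 8) → ℝ)
    (hF : ∀ σ, F (σ * Equiv.swap a b) = F σ) :
    ∑ σ : Equiv.Perm (Fin 8), ((Equiv.Perm.sign σ : ℤ) : ℝ) * F σ = 0 := by
  have h := Equiv.sum_comp (Equiv.mulRight (Equiv.swap a b))
    (fun σ : Equiv.Perm (Fin 8) => ((Equiv.Perm.sign σ : ℤ) : ℝ) * F σ)
  have h2 : ∀ σ : Equiv.Perm (Fin 8), ((Equiv.Perm.sign (σ * Equiv.swap a b) : ℤ) : ℝ)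
      = -((Equiv.Perm.sign σ : ℤ) : ℝ) := fun σ => by
    rw [Equiv.Perm.sign_mul, Equiv.Perm.sign_swap hab]; simp
  simp only [Equiv.coe_mulRight, hF, h2] at h
  simp only [neg_mul, Finset.sum_neg_distrib] at h
  linarith

/-- `v♭∧w♭∧v♭∧w♭∧Φ₀ = 0`. -/
lemma wedge_self_zero (v w : E8) (x : Fin 8 → E8) :
    wedge26 (fun a b => ⟪v, a⟫ * ⟪w, b⟫ - ⟪v, b⟫ * ⟪w, a⟫) (sixForm v w) x = 0 := by
  unfold wedge26 sixForm
  simp only [Finset.mul_sum]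
  rw [Finset.sum_comm]
  refine Finset.sum_eq_zero fun ρ _ => ?_
  let f : Fin 6 → Fin 8 := fun i => ⟨(ρ i).1 + 2, by omega⟩
  have hf0 : ∀ i, f i ≠ 0 := fun i h => by
    have := congrArg Fin.val h
    simp [f] at this
  have hf1 : ∀ i, f i ≠ 1 := fun i h => by
    have := congrArg Fin.val h
    simp [f] at this
  have hinj : ∀ i j, i ≠ j → f i ≠ f j := fun i j hij h => by
    apply hij
    simp only [f, Fin.ext_iff] at h
    exact ρ.injective (Fin.ext (by omega))
  let V : Equiv.Perm (Fin 8) → Fin 8 → ℝ := fun σ i => ⟪v, x (σ i)⟫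
  let W : Equiv.Perm (Fin 8) → Fin 8 → ℝ := fun σ i => ⟪w, x (σ i)⟫
  let Q : Equiv.Perm (Fin 8) → ℝ := fun σ =>
    Phi (x (σ (f 2))) (x (σ (f 3))) (x (σ (f 4))) (x (σ (f 5)))
  -- each monomial vanishes
  have key : ∀ a b c d : Fin 8, a ≠ c → b ≠ a → b ≠ c → d ≠ a → d ≠ c →
      (∀ k : Fin 6, 2 ≤ k → f k ≠ a ∧ f k ≠ c) →
      ∑ σ : Equiv.Perm (Fin 8), ((Equiv.Perm.sign σ : ℤ) : ℝ) *
        (V σ a * W σ b * (V σ c * W σ d) * Q σ) = 0 := by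
    intro a b c d hac hba hbc hda hdc hk
    refine sum_sign_zero a c hac _ fun σ => ?_
    have e : ∀ i, i ≠ a → i ≠ c → (σ * Equiv.swap a c) i = σ i := fun i h1 h2 => by
      rw [Equiv.Perm.mul_apply, Equiv.swap_apply_of_ne_of_ne h1 h2]
    have ea : (σ * Equiv.swap a c) a = σ c := by simp
    have ec : (σ * Equiv.swap a c) c = σ a := by simp
    have e2 := e _ (hk 2 (by decide)).1 (hk 2 (by decide)).2
    have e3 := e _ (hk 3 (by decide)).1 (hk 3 (by decide)).2
    have e4 := e _ (hk 4 (by decide)).1 (hk 4 (by decide)).2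
    have e5 := e _ (hk 5 (by decide)).1 (hk 5 (by decide)).2
    simp only [V, W, Q, ea, ec, e b hba hbc, e d hda hdc, e2, e3, e4, e5]
    ring
  have h01 : (0 : Fin 6) ≠ 1 := by decide
  have hk0 : ∀ k : Fin 6, 2 ≤ k → k ≠ 0 := by decide
  have hk1 : ∀ k : Fin 6, 2 ≤ k → k ≠ 1 := by decide
  have z1 : (0 : Fin 8) ≠ 1 := by decide
  have k1 := key 0 1 (f 0) (f 1) (hf0 0).symm z1.symm (hf1 0).symm (hf0 1) (hinj _ _ h01.symm)
    fun k hk => ⟨hf0 k, hinj _ _ (hk0 k hk)⟩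
  have k2 := key 0 1 (f 1) (f 0) (hf0 1).symm z1.symm (hf1 1).symm (hf0 0) (hinj _ _ h01)
    fun k hk => ⟨hf0 k, hinj _ _ (hk1 k hk)⟩
  have k3 := key 1 0 (f 0) (f 1) (hf1 0).symm z1 (hf0 0).symm (hf1 1) (hinj _ _ h01.symm)
    fun k hk => ⟨hf1 k, hinj _ _ (hk0 k hk)⟩
  have k4 := key 1 0 (f 1) (f 0) (hf1 1).symm z1 (hf0 1).symm (hf1 0) (hinj _ _ h01)
    fun k hk => ⟨hf1 k, hinj _ _ (hk1 k hk)⟩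
  have tot : ∑ σ : Equiv.Perm (Fin 8), (1 / 1440 : ℝ) * (1 / 48) *
      ((Equiv.Perm.sign ρ : ℤ) : ℝ) *
      (((Equiv.Perm.sign σ : ℤ) : ℝ) * (V σ 0 * W σ 1 * (V σ (f 0) * W σ (f 1)) * Q σ)
       - ((Equiv.Perm.sign σ : ℤ) : ℝ) * (V σ 0 * W σ 1 * (V σ (f 1) * W σ (f 0)) * Q σ)
       - ((Equiv.Perm.sign σ : ℤ) : ℝ) * (V σ 1 * W σ 0 * (V σ (f 0) * W σ (f 1)) * Q σ)
       + ((Equiv.Perm.sign σ : ℤ) : ℝ) * (V σ 1 * W σ 0 * (V σ (f 1) * W σ (f 0)) * Q σ))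
      = 0 := by
    rw [← Finset.mul_sum, Finset.sum_add_distrib, Finset.sum_sub_distrib,
      Finset.sum_sub_distrib, k1, k2, k3, k4]
    ring
  rw [← tot]
  refine Finset.sum_congr rfl fun σ _ => ?_
  simp only [V, W, Q, f]
  ring

lemma isForm2_wedge (v w : E8) :
    IsForm2 (fun a b => ⟪v, a⟫ * ⟪w, b⟫ - ⟪v, b⟫ * ⟪w, a⟫) := by
  refine ⟨fun a b => ?_, fun a a' b => ?_, fun r a b => ?_⟩
  · ring
  · simp only [inner_add_right]; ring
  · simp only [inner_smul_right]; ring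

lemma vol8_std : vol8 e₈ = 1 := by
  have : (Matrix.of fun i j : Fin 8 => e₈ i j) = (1 : Matrix (Fin 8) (Fin 8) ℝ) := by
    ext i j
    simp [e₈, Matrix.one_apply, eq_comm]
  rw [vol8, this, Matrix.det_one]

lemma det4 (a b c d e f g h i j k l m n o p : ℝ) :
    Matrix.det !![a,b,c,d;e,f,g,h;i,j,k,l;m,n,o,p] =
      a*(f*(k*p-l*o)-g*(j*p-l*n)+h*(j*o-k*n)) - b*(e*(k*p-l*o)-g*(i*p-l*m)+h*(i*o-k*m))
      + c*(e*(j*p-l*n)-f*(i*p-l*m)+h*(i*n-j*m)) - d*(e*(j*o-k*n)-f*(i*o-k*m)+g*(i*n-j*m)) := by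
  simp [Matrix.det_succ_row_zero, Fin.sum_univ_succ, Fin.succAbove]
  ring

lemma inner8 (x y : E8) : ⟪x, y⟫ = x 0 * y 0 + x 1 * y 1 + x 2 * y 2 + x 3 * y 3 + x 4 * y 4
    + x 5 * y 5 + x 6 * y 6 + x 7 * y 7 := by
  simp [PiLp.inner_apply, Fin.sum_univ_eight, mul_comm]

lemma e8_apply (i j : Fin 8) : e₈ i j = if j = i then 1 else 0 := by
  simp [e₈]

lemma inner_e8 (x : E8) (i : Fin 8) : ⟪x, e₈ i⟫ = x i := by
  rw [e₈, EuclideanSpace.inner_single_right]; simp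

lemma form_zero (β : E8 → E8 → ℝ) (hb : IsForm2 β)
    (hij : ∀ i j, i < j → β (e₈ i) (e₈ j) = 0) : ∀ a b, β a b = 0 := by
  have hall : ∀ i j, β (e₈ i) (e₈ j) = 0 := by
    intro i j
    rcases lt_trichotomy i j with h | h | h
    · exact hij i j h
    · subst h; have := hb.1 (e₈ i) (e₈ i); linarith
    · rw [hb.1, hij j i h, neg_zero]
  have lin : ∀ c : E8, (∀ i, β (e₈ i) c = 0) → ∀ a, β a c = 0 := by
    intro c hc a
    let L : E8 →ₗ[ℝ] ℝ :=
      { toFun := fun a => β a c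
        map_add' := fun a a' => hb.2.1 a a' c
        map_smul' := fun r a => hb.2.2 r a c }
    have hL : L = 0 := by
      apply (EuclideanSpace.basisFun (Fin 8) ℝ).toBasis.ext
      intro i
      simpa [L, e₈] using hc i
    exact congrArg (fun M : E8 →ₗ[ℝ] ℝ => M a) hL
  intro a b
  refine lin b (fun i => ?_) a
  rw [hb.1, lin _ (fun j => hall j i) b, neg_zero]

/-- The octonion product adapted to `Φ₀` (with unit `e₁`). -/
def octMul (a b : Fin 8 → ℝ) : Fin 8 → ℝ :=
  ![a 0 * b 0 - a 1 * b 1 - a 2 * b 2 - a 3 * b 3 - a 4 * b 4 - a 5 * b 5 - a 6 * b 6 - a 7 * b 7,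
    a 0 * b 1 + a 1 * b 0 + a 2 * b 3 - a 3 * b 2 + a 4 * b 5 - a 5 * b 4 - a 6 * b 7 + a 7 * b 6,
    a 0 * b 2 - a 1 * b 3 + a 2 * b 0 + a 3 * b 1 + a 4 * b 6 + a 5 * b 7 - a 6 * b 4 - a 7 * b 5,
    a 0 * b 3 + a 1 * b 2 - a 2 * b 1 + a 3 * b 0 + a 4 * b 7 - a 5 * b 6 + a 6 * b 5 - a 7 * b 4,
    a 0 * b 4 - a 1 * b 5 - a 2 * b 6 - a 3 * b 7 + a 4 * b 0 + a 5 * b 1 + a 6 * b 2 + a 7 * b 3,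
    a 0 * b 5 + a 1 * b 4 - a 2 * b 7 + a 3 * b 6 - a 4 * b 1 + a 5 * b 0 - a 6 * b 3 + a 7 * b 2,
    a 0 * b 6 + a 1 * b 7 + a 2 * b 4 - a 3 * b 5 - a 4 * b 2 + a 5 * b 3 + a 6 * b 0 - a 7 * b 1,
    a 0 * b 7 - a 1 * b 6 + a 2 * b 5 + a 3 * b 4 - a 4 * b 3 - a 5 * b 2 + a 6 * b 1 + a 7 * b 0]

/-- Octonion conjugation. -/
def octConj (a : Fin 8 → ℝ) : Fin 8 → ℝ :=
  ![a 0, -a 1, -a 2, -a 3, -a 4, -a 5, -a 6, -a 7]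

/-- Squared Euclidean norm. -/
def nsq (a : Fin 8 → ℝ) : ℝ :=
  a 0 ^ 2 + a 1 ^ 2 + a 2 ^ 2 + a 3 ^ 2 + a 4 ^ 2 + a 5 ^ 2 + a 6 ^ 2 + a 7 ^ 2

lemma nsq_mul (a b : Fin 8 → ℝ) : nsq (octMul a b) = nsq a * nsq b := by
  simp [nsq, octMul]
  ring

lemma nsq_conj (a : Fin 8 → ℝ) : nsq (octConj a) = nsq a := by
  simp [nsq, octConj]

set_option maxHeartbeats 4000000 in
lemma Phi_oct (y z w : E8) (i : Fin 8) :
    Phi (e₈ i) y z w = octMul (y ·) (octMul (octConj (z ·)) (w ·)) i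
      - (⟪y, z⟫ * w i + ⟪z, w⟫ * y i - ⟪y, w⟫ * z i) := by
  simp only [Phi, d4, det4, e8_apply, inner8]
  fin_cases i <;> simp [octMul, octConj] <;> ring

lemma norm_P_sq (P : E8 → E8 → E8 → E8)
    (hP : ∀ x y z w : E8, ⟪x, P y z w⟫ = Phi x y z w) (x y z w : E8)
    (ho : Orthonormal ℝ ![x, y, z, w]) : ⟪P y z w, P y z w⟫ = 1 := by
  have i12 : ⟪y, z⟫ = 0 := ho.2 (i := 1) (j := 2) (by decide)
  have i13 : ⟪y, w⟫ = 0 := ho.2 (i := 1) (j := 3) (by decide)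
  have i23 : ⟪z, w⟫ = 0 := ho.2 (i := 2) (j := 3) (by decide)
  have hn : ∀ u : E8, ‖u‖ = 1 → nsq (u ·) = 1 := fun u hu => by
    have h : ⟪u, u⟫ = 1 := by rw [real_inner_self_eq_norm_sq, hu]; norm_num
    rw [inner8] at h
    rw [← h, nsq]; ring
  have hi : ∀ i, P y z w i = octMul (y ·) (octMul (octConj (z ·)) (w ·)) i := fun i => by
    have h := hP (e₈ i) y z w
    rw [Phi_oct, i12, i13, i23, real_inner_comm, inner_e8] at h
    rw [h]; ring
  have hfin : ⟪P y z w, P y z w⟫ = nsq (octMul (y ·) (octMul (octConj (z ·)) (w ·))) := by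
    rw [inner8, nsq]; simp only [hi]; ring
  rw [hfin, nsq_mul, nsq_mul, nsq_conj, hn y (ho.1 1), hn z (ho.1 2), hn w (ho.1 3)]
  norm_num

/-- for orthonormal `x, y, z, w` in ℝ⁸, the 2-form `τ(x,y,z,w)` vanishes
iff `Φ₀(x,y,z,w) = ±1` (vanishing of τ characterizes Cayley 4-planes). Here
`τ(a,b,c,d) = −a×P(b,c,d) + ⟨a,b⟩(c×d) + ⟨a,c⟩(d×b) + ⟨a,d⟩(b×c)`,
`P` is the triple cross product (`⟨x, P(y,z,w)⟩ = Φ₀(x,y,z,w)`), and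
`v × w = ½(v♭∧w♭ − *(v♭∧w♭∧Φ₀))`, the Hodge star `*β` of a 6-form `β` being the
unique 2-form with `α ∧ β = ⟨α, *β⟩ vol` for every 2-form `α`. -/
theorem tau_eq_zero_iff_cayley
    (P : E8 → E8 → E8 → E8)
    (hP : ∀ x y z w : E8, ⟪x, P y z w⟫ = Phi x y z w)
    (star : ((Fin 6 → E8) → ℝ) → (E8 → E8 → ℝ))
    (hstar2 : ∀ v w : E8, IsForm2 (star (sixForm v w)))
    (hstar : ∀ v w : E8, ∀ α : E8 → E8 → ℝ, IsForm2 α →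
      ∀ x : Fin 8 → E8,
        wedge26 α (sixForm v w) x = innerF2 α (star (sixForm v w)) * vol8 x)
    (cross : E8 → E8 → E8 → E8 → ℝ)
    (hcross : ∀ v w a b : E8,
      cross v w a b =
        (1 / 2 : ℝ) * ((⟪v, a⟫ * ⟪w, b⟫ - ⟪v, b⟫ * ⟪w, a⟫) - star (sixForm v w) a b))
    (tau : E8 → E8 → E8 → E8 → E8 → E8 → ℝ)
    (htau : ∀ a b c d p q : E8,
      tau a b c d p q =
        -(cross a (P b c d) p q) + ⟪a, b⟫ * cross c d p q
          + ⟪a, c⟫ * cross d b p q + ⟪a, d⟫ * cross b c p q) :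
    ∀ x y z w : E8, Orthonormal ℝ ![x, y, z, w] →
      ((∀ p q : E8, tau x y z w p q = 0) ↔ Phi x y z w = 1 ∨ Phi x y z w = -1) := by
  intro x y z w ho
  have nx : ⟪x, x⟫ = 1 := by
    have h : ‖x‖ = 1 := ho.1 0
    rw [real_inner_self_eq_norm_sq, h]; norm_num
  have hpp : ⟪P y z w, P y z w⟫ = 1 := norm_P_sq P hP x y z w ho
  have hxp : ⟪x, P y z w⟫ = Phi x y z w := hP x y z w
  have i01 : ⟪x, y⟫ = 0 := ho.2 (i := 0) (j := 1) (by decide)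
  have i02 : ⟪x, z⟫ = 0 := ho.2 (i := 0) (j := 2) (by decide)
  have i03 : ⟪x, w⟫ = 0 := ho.2 (i := 0) (j := 3) (by decide)
  have ht : ∀ a b, tau x y z w a b = -(cross x (P y z w) a b) := fun a b => by
    rw [htau, i01, i02, i03]; ring
  generalize P y z w = p at *
  rw [← hxp]
  have hin : innerF2 (fun a b => ⟪x, a⟫ * ⟪p, b⟫ - ⟪x, b⟫ * ⟪p, a⟫) (star (sixForm x p)) = 0 := by
    have h := hstar x p _ (isForm2_wedge x p) e₈
    rw [wedge_self_zero, vol8_std, mul_one] at h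
    exact h.symm
  constructor
  · intro h
    have hs : star (sixForm x p) = fun a b => ⟪x, a⟫ * ⟪p, b⟫ - ⟪x, b⟫ * ⟪p, a⟫ := by
      funext a b
      have h1 := h a b
      rw [ht, hcross] at h1
      linarith
    rw [hs] at hin
    have hx : ∀ i, ⟪x, e₈ i⟫ = x i := fun i => inner_e8 _ i
    have hp : ∀ i, ⟪p, e₈ i⟫ = p i := fun i => inner_e8 _ i
    have hz : ⟪x, x⟫ * ⟪p, p⟫ - ⟪x, p⟫ ^ 2 = 0 := by
      rw [← hin]
      simp only [innerF2, hx, hp, Fin.sum_univ_eight, inner8]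
      simp [Fin.lt_def]
      ring
    rw [nx, hpp] at hz
    have : (⟪x, p⟫ - 1) * (⟪x, p⟫ + 1) = 0 := by linarith
    rcases mul_eq_zero.1 this with h | h
    · left; linarith
    · right; linarith
  · intro h
    have hc : ∃ c : ℝ, p = c • x := by
      rcases h with h | h
      · refine ⟨1, ?_⟩
        have : ⟪p - x, p - x⟫ = 0 := by
          rw [inner_sub_left, inner_sub_right, inner_sub_right, real_inner_comm, nx, hpp,
            real_inner_comm, h]; norm_num [h, real_inner_comm]
        rw [one_smul]
        exact sub_eq_zero.1 (inner_self_eq_zero.1 this)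
      · refine ⟨-1, ?_⟩
        have : ⟪p + x, p + x⟫ = 0 := by
          rw [real_inner_add_add_self, nx, hpp, real_inner_comm, h]; norm_num
        rw [neg_one_smul]
        exact eq_neg_of_add_eq_zero_left (inner_self_eq_zero.1 this)
    obtain ⟨c, hc⟩ := hc
    have hA : ∀ a b : E8, ⟪x, a⟫ * ⟪p, b⟫ - ⟪x, b⟫ * ⟪p, a⟫ = 0 := fun a b => by
      rw [hc]; simp only [inner_smul_left]; simp; ring
    have h6 : sixForm x p = fun _ => 0 := by
      funext u
      simp only [sixForm, hA]
      simp
    -- the star of zero vanishes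
    set β := star (sixForm x p) with hβ
    have hββ : innerF2 β β = 0 := by
      have h := hstar x p β (hstar2 x p) e₈
      rw [vol8_std, mul_one] at h
      rw [hβ, ← h, h6]
      simp [wedge26]
    have hb := hstar2 x p
    have hij : ∀ i j, i < j → β (e₈ i) (e₈ j) = 0 := by
      intro i j hlt
      have nn : ∀ i j : Fin 8, 0 ≤ (if i < j then β (e₈ i) (e₈ j) * β (e₈ i) (e₈ j) else 0) := by
        intro i j; split_ifs
        · exact mul_self_nonneg _
        · exact le_rfl
      have h1 := (Finset.sum_eq_zero_iff_of_nonneg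
        (fun i _ => Finset.sum_nonneg fun j _ => nn i j)).1 hββ i (Finset.mem_univ _)
      have h2 := (Finset.sum_eq_zero_iff_of_nonneg (fun j _ => nn i j)).1 h1 j (Finset.mem_univ _)
      rw [if_pos hlt] at h2
      exact mul_self_eq_zero.1 h2
    have hβ0 : ∀ a b, β a b = 0 := form_zero β hb hij
    intro a b
    rw [ht, hcross, hA, ← hβ, hβ0]
    ring
end
end

section
/- Every linear map A : ℝ⁸ → ℝ⁸ satisfying Φ₀(Ax, Ay, Az, Aw) = Φ₀(x,y,z,w) for all x, y, z, w ∈ ℝ⁸ is a special orthogonal transformation: ⟨Ax, Ay⟩ = ⟨x, y⟩ for all x, y and det A = 1 (the stabilizer Spin(7) of Φ₀ is contained in SO(8)). -/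
noncomputable section
open scoped RealInnerProductSpace

def tabP : Nat := 8410671224972569669568419742960520015944774677002800181133333175222656283893630786032310569852801954712058146874671917292959354698317872218609758540800
def tabN : Nat := 4554573189458906859655756219655111386575212383976413218447770105712478079840898641028233876555169910752223180919260012284961117488568846026842889676800

/-- Sign of the coefficient of the Cayley form at `(i, j, k, i xor j xor k)`. -/
def tab (i j k : Fin 8) : ℤ :=
  if tabP.testBit (64 * i.val + 8 * j.val + k.val) then 1
  else if tabN.testBit (64 * i.val + 8 * j.val + k.val) then -1 else 0

/-- Components of the Cayley form. -/
def phi (i j k l : Fin 8) : ℤ := if i ^^^ j ^^^ k = l then tab i j k else 0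

def del (i j : Fin 8) : ℤ := if i = j then 1 else 0

def sum8 (g : Fin 8 → ℤ) : ℤ := g 0 + g 1 + g 2 + g 3 + g 4 + g 5 + g 6 + g 7

theorem sum8_eq (g : Fin 8 → ℤ) : sum8 g = ∑ i, g i := by
  rw [Fin.sum_univ_eight]; rfl

def sg (i j : Fin 8) : ℤ := if i < j then 1 else if j < i then -1 else 0

/-- Short-circuiting multiplication. -/
def zmul (a b : ℤ) : ℤ := if a = 0 then 0 else a * b

theorem zmul_eq (a b : ℤ) : zmul a b = a * b := by
  unfold zmul; split_ifs with h <;> simp [h]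

def eps (i j k l p q r s : Fin 8) : ℤ :=
  zmul (sg i j * sg i k * sg j k * sg i l * sg j l * sg k l) <|
  zmul (zmul (sg i p) <| zmul (sg j p) <| zmul (sg k p) (sg l p)) <|
  zmul (zmul (sg i q) <| zmul (sg j q) <| zmul (sg k q) <| zmul (sg l q) (sg p q)) <|
  zmul (zmul (sg i r) <| zmul (sg j r) <| zmul (sg k r) <| zmul (sg l r) <|
    zmul (sg p r) (sg q r))
  (zmul (sg i s) <| zmul (sg j s) <| zmul (sg k s) <| zmul (sg l s) <|
    zmul (sg p s) <| zmul (sg q s) (sg r s))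

set_option maxRecDepth 100000 in
theorem checkA : ∀ i j m n : Fin 8,
    sum8 (fun a => tab i j a * phi a (i ^^^ j ^^^ a) m n) =
      6 * (del i m * del j n - del i n * del j m) - 4 * phi i j m n := by
  decide +kernel

set_option maxRecDepth 100000 in
theorem checkB : ∀ i j : Fin 8, i < j → ∀ k, j < k → ∀ l, k < l →
    sum8 (fun p => sum8 fun q => sum8 fun r =>
      zmul (eps i j k l p q r (p ^^^ q ^^^ r)) (tab p q r)) = 24 * phi i j k l := by
  decide +kernel

def D3 (p q r j k l : Fin 8) : ℤ :=
  zmul (del j p) (del k q * del l r - del k r * del l q)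
  - zmul (del j q) (del k p * del l r - del k r * del l p)
  + zmul (del j r) (del k p * del l q - del k q * del l p)

/-- The coefficients of the Cayley form, expanded along the first index. -/
def phiExp (i j k l : Fin 8) : ℤ :=
  zmul (del i 0)
  (D3 1 2 3 j k l + D3 1 4 5 j k l - D3 1 6 7 j k l
      + D3 2 4 6 j k l + D3 2 5 7 j k l + D3 3 4 7 j k l
      - D3 3 5 6 j k l) +
  zmul (del i 1)
  (-D3 0 2 3 j k l - D3 0 4 5 j k l + D3 0 6 7 j k l
      - D3 2 4 7 j k l + D3 2 5 6 j k l + D3 3 4 6 j k l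
      + D3 3 5 7 j k l) +
  zmul (del i 2)
  (D3 0 1 3 j k l - D3 0 4 6 j k l - D3 0 5 7 j k l
      + D3 1 4 7 j k l - D3 1 5 6 j k l - D3 3 4 5 j k l
      + D3 3 6 7 j k l) +
  zmul (del i 3)
  (-D3 0 1 2 j k l - D3 0 4 7 j k l + D3 0 5 6 j k l
      - D3 1 4 6 j k l - D3 1 5 7 j k l + D3 2 4 5 j k l
      - D3 2 6 7 j k l) +
  zmul (del i 4)
  (D3 0 1 5 j k l + D3 0 2 6 j k l + D3 0 3 7 j k l
      - D3 1 2 7 j k l + D3 1 3 6 j k l - D3 2 3 5 j k l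
      + D3 5 6 7 j k l) +
  zmul (del i 5)
  (-D3 0 1 4 j k l + D3 0 2 7 j k l - D3 0 3 6 j k l
      + D3 1 2 6 j k l + D3 1 3 7 j k l + D3 2 3 4 j k l
      - D3 4 6 7 j k l) +
  zmul (del i 6)
  (-D3 0 1 7 j k l - D3 0 2 4 j k l + D3 0 3 5 j k l
      - D3 1 2 5 j k l - D3 1 3 4 j k l + D3 2 3 7 j k l
      + D3 4 5 7 j k l) +
  zmul (del i 7)
  (D3 0 1 6 j k l - D3 0 2 5 j k l - D3 0 3 4 j k l
      + D3 1 2 4 j k l - D3 1 3 5 j k l - D3 2 3 6 j k l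
      - D3 4 5 6 j k l)

set_option maxRecDepth 100000 in
theorem checkC : ∀ i j k l : Fin 8, phiExp i j k l = phi i j k l := by
  decide +kernel

open Matrix

/-- Standard basis vectors. -/
def bv (i : Fin 8) : E8 := EuclideanSpace.single i (1 : ℝ)

theorem bv_apply (i p : Fin 8) : bv i p = ((del i p : ℤ) : ℝ) := by
  unfold bv del
  by_cases h : i = p
  · simp [h]
  · have h' : p ≠ i := fun hh => h hh.symm
    simp [h, h']

/-- `d4` as an alternating map. -/
def d4Alt (i j k l : Fin 8) : E8 [⋀^Fin 4]→ₗ[ℝ] ℝ :=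
  (Matrix.detRowAlternating (n := Fin 4) (R := ℝ)).compLinearMap
    { toFun := fun x => ![x i, x j, x k, x l]
      map_add' := by intro x y; ext m; fin_cases m <;> simp
      map_smul' := by intro c x; ext m; fin_cases m <;> simp }

theorem d4Alt_apply (i j k l : Fin 8) (v : Fin 4 → E8) :
    d4Alt i j k l v = d4 i j k l (v 0) (v 1) (v 2) (v 3) := by
  unfold d4Alt d4
  rw [AlternatingMap.compLinearMap_apply]
  change Matrix.det _ = _
  congr 1
  ext m n
  fin_cases m <;> rfl

/-- `Phi` as an alternating map. -/
def PhiAlt : E8 [⋀^Fin 4]→ₗ[ℝ] ℝ :=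
  d4Alt 0 1 2 3 + d4Alt 0 1 4 5 - d4Alt 0 1 6 7
    + d4Alt 0 2 4 6 + d4Alt 0 2 5 7 + d4Alt 0 3 4 7
    - d4Alt 0 3 5 6 - d4Alt 1 2 4 7 + d4Alt 1 2 5 6
    + d4Alt 1 3 4 6 + d4Alt 1 3 5 7 - d4Alt 2 3 4 5
    + d4Alt 2 3 6 7 + d4Alt 4 5 6 7

theorem PhiAlt_apply (v : Fin 4 → E8) : PhiAlt v = Phi (v 0) (v 1) (v 2) (v 3) := by
  simp only [PhiAlt, AlternatingMap.add_apply, AlternatingMap.sub_apply, d4Alt_apply, Phi]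

theorem d4_bv (p q r s i j k l : Fin 8) :
    d4 p q r s (bv i) (bv j) (bv k) (bv l) =
      (((del i p * D3 q r s j k l - del i q * D3 p r s j k l
        + del i r * D3 p q s j k l - del i s * D3 p q r j k l : ℤ)) : ℝ) := by
  unfold d4 D3
  simp only [bv_apply, zmul_eq]
  simp [Matrix.det_succ_row_zero, Fin.sum_univ_succ, Fin.succAbove]
  ring

theorem Phi_bv (i j k l : Fin 8) : Phi (bv i) (bv j) (bv k) (bv l) = ((phi i j k l : ℤ) : ℝ) := by
  rw [← checkC]
  unfold Phi phiExp
  simp only [d4_bv, zmul_eq]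
  push_cast
  ring

/-- Components of the Cayley form, as a real vector. -/
def fv (I : Fin 4 → Fin 8) : ℝ := PhiAlt (fun m => bv (I m))

theorem fv_eq (I : Fin 4 → Fin 8) : fv I = ((phi (I 0) (I 1) (I 2) (I 3) : ℤ) : ℝ) := by
  rw [fv, PhiAlt_apply, Phi_bv]

/-- The Levi-Civita symbol. -/
def lev (v : Fin 8 → Fin 8) : ℝ := ((1 : Matrix (Fin 8) (Fin 8) ℝ).submatrix v id).det

theorem lev_eq (v : Fin 8 → Fin 8) :
    lev v = ((∏ i, ∏ j ∈ Finset.Ioi i, sg (v i) (v j) : ℤ) : ℝ) := by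
  by_cases h : Function.Injective v
  · let σ : Equiv.Perm (Fin 8) := Equiv.ofBijective v (Finite.injective_iff_bijective.1 h)
    have h1 : lev v = ((Equiv.Perm.sign σ : ℤ) : ℝ) := by
      have := Matrix.det_permute σ (1 : Matrix (Fin 8) (Fin 8) ℝ)
      rw [Matrix.det_one, mul_one] at this
      exact this
    rw [h1, Equiv.Perm.sign_eq_prod_prod_Ioi]
    push_cast
    refine Finset.prod_congr rfl fun i _ => Finset.prod_congr rfl fun j hj => ?_
    have hij : i < j := Finset.mem_Ioi.1 hj
    have hne : v i ≠ v j := fun hh => hij.ne (h hh)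
    have hσ : ∀ m, σ m = v m := fun m => rfl
    rw [hσ, hσ]
    unfold sg
    by_cases hlt : v i < v j
    · simp [hlt]
    · have : v j < v i := lt_of_le_of_ne (not_lt.1 hlt) hne.symm
      simp [hlt, this]
  · obtain ⟨i, j, hij, hne⟩ : ∃ i j, v i = v j ∧ i ≠ j := by
      simpa [Function.Injective] using h
    have h0 : lev v = 0 := Matrix.det_zero_of_row_eq hne (by funext n; rw [Matrix.submatrix_apply, hij, Matrix.submatrix_apply])
    rw [h0]
    have key : ∀ i j : Fin 8, v i = v j → i < j →
        (∏ i, ∏ j ∈ Finset.Ioi i, sg (v i) (v j)) = 0 := by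
      intro i j hij hlt
      refine Finset.prod_eq_zero (Finset.mem_univ i) ?_
      refine Finset.prod_eq_zero (Finset.mem_Ioi.2 hlt) ?_
      simp [sg, hij]
    rcases lt_or_gt_of_ne hne with hlt | hlt
    · rw [key i j hij hlt]; simp
    · rw [key j i hij.symm hlt]; simp

theorem lev_eps (i j k l p q r s : Fin 8) :
    lev (Fin.append ![i, j, k, l] ![p, q, r, s]) = ((eps i j k l p q r s : ℤ) : ℝ) := by
  have hv : Fin.append ![i, j, k, l] ![p, q, r, s] = ![i, j, k, l, p, q, r, s] := by
    ext m; fin_cases m <;> rfl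
  have e0 : Finset.Ioi (0 : Fin 8) = {1, 2, 3, 4, 5, 6, 7} := by decide
  have e1 : Finset.Ioi (1 : Fin 8) = {2, 3, 4, 5, 6, 7} := by decide
  have e2 : Finset.Ioi (2 : Fin 8) = {3, 4, 5, 6, 7} := by decide
  have e3 : Finset.Ioi (3 : Fin 8) = {4, 5, 6, 7} := by decide
  have e4 : Finset.Ioi (4 : Fin 8) = {5, 6, 7} := by decide
  have e5 : Finset.Ioi (5 : Fin 8) = {6, 7} := by decide
  have e6 : Finset.Ioi (6 : Fin 8) = {7} := by decide
  have e7 : Finset.Ioi (7 : Fin 8) = ∅ := by decide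
  rw [lev_eq, hv, Fin.prod_univ_eight, e0, e1, e2, e3, e4, e5, e6, e7]
  unfold eps
  simp only [zmul_eq]
  congr 1
  simp [Finset.prod_insert]
  ring

/-- Quadruples as functions. -/
def quad : (Fin 8 × Fin 8) × (Fin 8 × Fin 8) ≃ (Fin 4 → Fin 8) where
  toFun x := ![x.1.1, x.1.2, x.2.1, x.2.2]
  invFun v := ((v 0, v 1), (v 2, v 3))
  left_inv x := rfl
  right_inv v := by ext m; fin_cases m <;> rfl

theorem sum_quad (g : (Fin 4 → Fin 8) → ℝ) :
    ∑ v, g v = ∑ p, ∑ q, ∑ r, ∑ s, g ![p, q, r, s] := by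
  rw [← Equiv.sum_comp quad g]
  simp only [Fintype.sum_prod_type]
  rfl

theorem lev_append_perm (I Q : Fin 4 → Fin 8) (σ : Equiv.Perm (Fin 4)) :
    lev (Fin.append (I ∘ σ) Q) = ((Equiv.Perm.sign σ : ℤ) : ℝ) * lev (Fin.append I Q) := by
  let τ : Equiv.Perm (Fin (4 + 4)) := (finSumFinEquiv (m := 4) (n := 4)).permCongr (Equiv.sumCongr σ 1)
  have hs : Equiv.Perm.sign τ = Equiv.Perm.sign σ := by
    simp only [τ, Equiv.Perm.sign_permCongr]
    exact (Equiv.Perm.sign_sumCongr σ 1).trans (by simp)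
  have hτ : Fin.append (I ∘ σ) Q = Fin.append I Q ∘ τ := by
    funext m
    refine Fin.addCases (fun m => ?_) (fun m => ?_) m
    · have : τ (Fin.castAdd 4 m) = Fin.castAdd 4 (σ m) := by
        simp only [τ, Equiv.permCongr_apply, finSumFinEquiv_symm_apply_castAdd]
        rfl
      rw [Function.comp_apply, this, Fin.append_left, Fin.append_left, Function.comp_apply]
    · have : τ (Fin.natAdd 4 m) = Fin.natAdd 4 m := by
        simp only [τ, Equiv.permCongr_apply, finSumFinEquiv_symm_apply_natAdd]
        rfl
      rw [Function.comp_apply, this, Fin.append_right, Fin.append_right]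
  rw [← hs, hτ]
  exact Matrix.det_permute τ ((1 : Matrix (Fin 8) (Fin 8) ℝ).submatrix (Fin.append I Q) id)

theorem self_dual (I : Fin 4 → Fin 8) : ∑ Q, lev (Fin.append I Q) * fv Q = 24 * fv I := by
  by_cases hI : Function.Injective I
  swap
  · have h1 : fv I = 0 := by
      refine AlternatingMap.map_eq_zero_of_not_injective _ _ fun hh => hI ?_
      intro a b hab
      exact hh (by simp [hab])
    rw [h1, mul_zero]
    refine Finset.sum_eq_zero fun Q _ => ?_
    obtain ⟨i, j, hij, hne⟩ : ∃ i j, I i = I j ∧ i ≠ j := by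
      simpa [Function.Injective] using hI
    have : lev (Fin.append I Q) = 0 := by
      refine Matrix.det_zero_of_row_eq (i := Fin.castAdd 4 i) (j := Fin.castAdd 4 j) ?_ ?_
      · intro hh; exact hne (Fin.castAdd_injective 4 4 hh)
      · funext n
        simp only [Matrix.submatrix_apply]
        rw [Fin.append_left, Fin.append_left, hij]
    rw [this, zero_mul]
  · have main : ∀ J : Fin 4 → Fin 8, StrictMono J →
        ∑ Q, lev (Fin.append J Q) * fv Q = 24 * fv J := by
      intro J hJ
      have hJ4 : J = ![J 0, J 1, J 2, J 3] := by ext m; fin_cases m <;> rfl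
      have hc := checkB (J 0) (J 1) (hJ (by decide)) (J 2) (hJ (by decide)) (J 3) (hJ (by decide))
      have hc' := congrArg (fun z : ℤ => (z : ℝ)) hc
      simp only [sum8_eq, zmul_eq] at hc'
      push_cast at hc'
      rw [fv_eq, ← hc', sum_quad]
      refine Finset.sum_congr rfl fun p _ => Finset.sum_congr rfl fun q _ =>
        Finset.sum_congr rfl fun r _ => ?_
      rw [Finset.sum_eq_single (p ^^^ q ^^^ r)]
      · rw [hJ4, lev_eps, fv_eq]
        simp [phi]
      · intro s _ hs
        rw [fv_eq]
        simp [phi, hs.symm]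
      · intro h; exact absurd (Finset.mem_univ _) h
    have hsm : StrictMono (I ∘ Tuple.sort I) :=
      (Tuple.monotone_sort I).strictMono_of_injective (hI.comp (Tuple.sort I).injective)
    have h2 := main _ hsm
    have hf : fv (I ∘ Tuple.sort I) = ((Equiv.Perm.sign (Tuple.sort I) : ℤ) : ℝ) * fv I := by
      have := PhiAlt.map_perm (fun m => bv (I m)) (Tuple.sort I)
      rw [Units.smul_def, zsmul_eq_mul] at this
      exact this
    simp only [lev_append_perm, hf, mul_assoc, ← Finset.mul_sum] at h2
    have hne : ((Equiv.Perm.sign (Tuple.sort I) : ℤ) : ℝ) ≠ 0 := by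
      exact_mod_cast Units.ne_zero _
    have h3 : ((Equiv.Perm.sign (Tuple.sort I) : ℤ) : ℝ) *
        (∑ Q, lev (Fin.append I Q) * fv Q) =
        ((Equiv.Perm.sign (Tuple.sort I) : ℤ) : ℝ) * (24 * fv I) := by
      rw [h2]; ring
    exact mul_left_cancel₀ hne h3

theorem det_expand {n : Type*} [Fintype n] [DecidableEq n] (a : Matrix n n ℝ) (w : n → n) :
    ∑ v : n → n, (∏ m, a (w m) (v m)) * ((1 : Matrix n n ℝ).submatrix v id).det =
      (a.submatrix w id).det := by
  have h2 : a.submatrix w id = fun m => ∑ k, a (w m) k • (1 : Matrix n n ℝ) k := by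
    ext m k
    simp [Finset.sum_apply, Matrix.one_apply]
  have h3 := (Matrix.detRowAlternating (n := n) (R := ℝ)).toMultilinearMap.map_sum
    (fun m k => a (w m) k • (1 : Matrix n n ℝ) k)
  have h4 : (a.submatrix w id).det =
    ∑ r : n → n, Matrix.detRowAlternating
      (fun m => a (w m) (r m) • (1 : Matrix n n ℝ) (r m)) := by
    rw [h2]; exact h3
  rw [h4]
  refine Finset.sum_congr rfl fun r _ => ?_
  have := (Matrix.detRowAlternating (n := n) (R := ℝ)).toMultilinearMap.map_smul_univ
    (fun m => a (w m) (r m)) (fun m => (1 : Matrix n n ℝ) (r m))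
  exact this.symm

theorem lev_mul (a : Matrix (Fin 8) (Fin 8) ℝ) (w : Fin 8 → Fin 8) :
    ∑ v : Fin 8 → Fin 8, (∏ m, a (w m) (v m)) * lev v = a.det * lev w := by
  have h1 : (a.submatrix w id).det = a.det * lev w := by
    rw [lev, mul_comm, ← Matrix.det_mul]
    congr 1
    ext m n
    simp [Matrix.mul_apply, Matrix.one_apply]
  rw [← h1]
  exact det_expand a w

/-- Product of four entries. -/
def pr (a : Matrix (Fin 8) (Fin 8) ℝ) (I P : Fin 4 → Fin 8) : ℝ := ∏ m, a (I m) (P m)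

theorem lev_mul' (a : Matrix (Fin 8) (Fin 8) ℝ) (I Q : Fin 4 → Fin 8) :
    ∑ P, ∑ P', pr a I P * pr a Q P' * lev (Fin.append P P') = a.det * lev (Fin.append I Q) := by
  rw [← lev_mul, ← Equiv.sum_comp (Fin.appendEquiv 4 4), Fintype.sum_prod_type]
  refine Finset.sum_congr rfl fun P _ => Finset.sum_congr rfl fun P' _ => ?_
  congr 1
  have := Fin.prod_univ_add (a := 4) (b := 4)
    (fun m => a (Fin.append I Q m) (Fin.append P P' m))
  simp only [Fin.append_left, Fin.append_right] at this
  exact this.symm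

theorem transpose_pres (a : Matrix (Fin 8) (Fin 8) ℝ)
    (h : ∀ I, ∑ P, pr a P I * fv P = fv I) (I : Fin 4 → Fin 8) :
    ∑ P, pr a I P * fv P = a.det * fv I := by
  have h1 : ∀ P, 24 * fv P = ∑ P', ∑ Q, lev (Fin.append P P') * (pr a Q P' * fv Q) := by
    intro P
    rw [← self_dual]
    refine Finset.sum_congr rfl fun P' _ => ?_
    rw [← h P', Finset.mul_sum]
  have h2 : 24 * ∑ P, pr a I P * fv P = 24 * (a.det * fv I) := by
    calc 24 * ∑ P, pr a I P * fv P = ∑ P, pr a I P * (24 * fv P) := by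
          rw [Finset.mul_sum]
          exact Finset.sum_congr rfl fun P _ => by ring
      _ = ∑ P, ∑ P', ∑ Q, pr a I P * (lev (Fin.append P P') * (pr a Q P' * fv Q)) := by
          refine Finset.sum_congr rfl fun P _ => ?_
          rw [h1, Finset.mul_sum]
          exact Finset.sum_congr rfl fun P' _ => by rw [Finset.mul_sum]
      _ = ∑ P, ∑ Q, ∑ P', pr a I P * (lev (Fin.append P P') * (pr a Q P' * fv Q)) :=
          Finset.sum_congr rfl fun P _ => Finset.sum_comm
      _ = ∑ Q, ∑ P, ∑ P', pr a I P * (lev (Fin.append P P') * (pr a Q P' * fv Q)) :=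
          Finset.sum_comm
      _ = ∑ Q, (a.det * lev (Fin.append I Q)) * fv Q := by
          refine Finset.sum_congr rfl fun Q _ => ?_
          rw [← lev_mul', Finset.sum_mul]
          refine Finset.sum_congr rfl fun P _ => ?_
          rw [Finset.sum_mul]
          exact Finset.sum_congr rfl fun P' _ => by ring
      _ = a.det * ∑ Q, lev (Fin.append I Q) * fv Q := by
          rw [Finset.mul_sum]
          exact Finset.sum_congr rfl fun Q _ => by ring
      _ = 24 * (a.det * fv I) := by rw [self_dual]; ring
  linarith

theorem det_eq_one (a : Matrix (Fin 8) (Fin 8) ℝ)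
    (h : ∀ I, ∑ P, pr a P I * fv P = fv I) : a.det = 1 := by
  have h1 : ∑ I, fv I * ∑ P, pr a I P * fv P = a.det * ∑ I, fv I * fv I := by
    rw [Finset.mul_sum]
    exact Finset.sum_congr rfl fun I _ => by rw [transpose_pres a h]; ring
  have h2 : ∑ I, fv I * ∑ P, pr a I P * fv P = ∑ P, fv P * fv P := by
    simp only [Finset.mul_sum]
    rw [Finset.sum_comm]
    refine Finset.sum_congr rfl fun P _ => ?_
    conv_rhs => rw [← h P]
    rw [h P]
    conv_rhs => arg 2; rw [← h P]
    rw [Finset.mul_sum]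
    exact Finset.sum_congr rfl fun I _ => by ring
  have hpos : 0 < ∑ I, fv I * fv I := by
    refine Finset.sum_pos' (fun I _ => mul_self_nonneg _) ⟨![0, 1, 2, 3], Finset.mem_univ _, ?_⟩
    have : fv ![0, 1, 2, 3] = 1 := by
      rw [fv_eq]
      have : phi 0 1 2 3 = 1 := by decide +kernel
      simp [this]
    rw [this]; norm_num
  rw [h1] at h2
  exact mul_right_cancel₀ hpos.ne' (by rw [h2, one_mul])

/-- The Cayley form as an operator on pairs. -/
def FM : Matrix (Fin 8 × Fin 8) (Fin 8 × Fin 8) ℝ :=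
  fun x y => ((phi x.1 x.2 y.1 y.2 : ℤ) : ℝ)

/-- Tensor square. -/
def BM (a : Matrix (Fin 8) (Fin 8) ℝ) : Matrix (Fin 8 × Fin 8) (Fin 8 × Fin 8) ℝ :=
  fun x y => a x.1 y.1 * a x.2 y.2

/-- Antisymmetrizer. -/
def WM : Matrix (Fin 8 × Fin 8) (Fin 8 × Fin 8) ℝ :=
  fun x y => ((del x.1 y.1 * del x.2 y.2 - del x.1 y.2 * del x.2 y.1 : ℤ) : ℝ)

theorem FM_sq : FM * FM = 6 • WM - 4 • FM := by
  ext ⟨i, j⟩ ⟨m, n⟩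
  have hc := congrArg (fun z : ℤ => (z : ℝ)) (checkA i j m n)
  simp only [sum8_eq] at hc
  simp only [Matrix.mul_apply, Fintype.sum_prod_type, Matrix.sub_apply, Matrix.smul_apply, FM, WM]
  push_cast at hc ⊢
  simp only [nsmul_eq_mul]
  push_cast
  rw [← hc]
  refine Finset.sum_congr rfl fun p _ => ?_
  rw [Finset.sum_eq_single (i ^^^ j ^^^ p)]
  · simp [phi]
  · intro s _ hs
    simp [phi, hs.symm]
  · intro h; exact absurd (Finset.mem_univ _) h

theorem WM_mul (a : Matrix (Fin 8) (Fin 8) ℝ) (x y : Fin 8 × Fin 8) :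
    (WM * BM a) x y = a x.1 y.1 * a x.2 y.2 - a x.2 y.1 * a x.1 y.2 := by
  simp only [Matrix.mul_apply, Fintype.sum_prod_type, WM, BM, del]
  push_cast
  simp [sub_mul, Finset.sum_sub_distrib]

theorem mul_WM (a : Matrix (Fin 8) (Fin 8) ℝ) (x y : Fin 8 × Fin 8) :
    (BM a * WM) x y = a x.1 y.1 * a x.2 y.2 - a x.1 y.2 * a x.2 y.1 := by
  simp only [Matrix.mul_apply, Fintype.sum_prod_type, WM, BM, del]
  push_cast
  simp [mul_sub, Finset.sum_sub_distrib]

theorem WM_comm (a : Matrix (Fin 8) (Fin 8) ℝ) : WM * BM a = BM a * WM := by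
  ext x y
  rw [WM_mul, mul_WM]
  ring

theorem BM_mul (a b : Matrix (Fin 8) (Fin 8) ℝ) : BM a * BM b = BM (a * b) := by
  ext x y
  simp only [Matrix.mul_apply, Fintype.sum_prod_type, BM, Finset.sum_mul_sum]
  exact Finset.sum_congr rfl fun p _ => Finset.sum_congr rfl fun q _ => by ring

/-- A sum over quadruples as a matrix triple product. -/
theorem triple (a : Matrix (Fin 8) (Fin 8) ℝ) (x y : Fin 8 × Fin 8) :
    (BM a * FM * BM aᵀ) x y = ∑ P, pr a (quad (x, y)) P * fv P := by
  rw [sum_quad]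
  simp only [Matrix.mul_apply, Fintype.sum_prod_type, Finset.sum_mul, BM, FM, fv_eq, pr,
    Fin.prod_univ_four, Matrix.transpose_apply]
  have hswap : ∀ g : Fin 8 → Fin 8 → Fin 8 → Fin 8 → ℝ,
      ∑ r, ∑ s, ∑ p, ∑ q, g p q r s = ∑ p, ∑ q, ∑ r, ∑ s, g p q r s := by
    intro g
    have h := Finset.sum_comm (s := (Finset.univ : Finset (Fin 8 × Fin 8)))
      (t := (Finset.univ : Finset (Fin 8 × Fin 8))) (f := fun a b => g b.1 b.2 a.1 a.2)
    simpa only [Fintype.sum_prod_type] using h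
  rw [hswap]
  refine Finset.sum_congr rfl fun p _ => Finset.sum_congr rfl fun q _ =>
    Finset.sum_congr rfl fun r _ => Finset.sum_congr rfl fun s _ => ?_
  change a x.1 p * a x.2 q * ((phi p q r s : ℤ) : ℝ) * (a y.1 r * a y.2 s) =
    a x.1 p * a x.2 q * a y.1 r * a y.2 s * ((phi p q r s : ℤ) : ℝ)
  ring

theorem FM_eq (x y : Fin 8 × Fin 8) : FM x y = fv (quad (x, y)) := by
  rw [fv_eq]; rfl

theorem minors (a : Matrix (Fin 8) (Fin 8) ℝ)
    (h : ∀ I, ∑ P, pr a P I * fv P = fv I) : WM * BM (aᵀ * a) = WM := by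
  have hd := det_eq_one a h
  have h1 : BM aᵀ * FM * BM a = FM := by
    ext x y
    have := triple aᵀ x y
    rw [Matrix.transpose_transpose] at this
    rw [this, FM_eq, ← h]
    rfl
  have h2 : BM a * FM * BM aᵀ = FM := by
    ext x y
    rw [triple, FM_eq, transpose_pres a h, hd, one_mul]
  have h3 : BM aᵀ * (FM * FM) = FM * FM * BM aᵀ := by
    calc BM aᵀ * (FM * FM) = BM aᵀ * FM * (BM a * FM * BM aᵀ) := by rw [h2, Matrix.mul_assoc]
      _ = (BM aᵀ * FM * BM a) * FM * BM aᵀ := by simp only [Matrix.mul_assoc]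
      _ = FM * FM * BM aᵀ := by rw [h1]
  have h4 : BM aᵀ * FM = FM * BM aᵀ := by
    rw [FM_sq, Matrix.mul_sub, Matrix.sub_mul, Matrix.mul_smul, Matrix.mul_smul,
      Matrix.smul_mul, Matrix.smul_mul, WM_comm] at h3
    have h5 := sub_right_injective h3
    ext x y
    have h6 := congrFun (congrFun h5 x) y
    simpa using h6
  have h5 : FM * BM (aᵀ * a) = FM := by
    rw [← BM_mul, ← Matrix.mul_assoc, ← h4, h1]
  have h6 : FM * FM * BM (aᵀ * a) = FM * FM := by
    rw [Matrix.mul_assoc, h5]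
  rw [FM_sq, Matrix.sub_mul, Matrix.smul_mul, Matrix.smul_mul, h5] at h6
  have h7 := sub_left_injective h6
  ext x y
  have h8 := congrFun (congrFun h7 x) y
  simpa using h8

theorem eq_one_of_minors (s : Matrix (Fin 8) (Fin 8) ℝ) (hsym : ∀ i j, s i j = s j i)
    (hpos : ∀ i, 0 ≤ s i i) (h : WM * BM s = WM) : s = 1 := by
  have hm : ∀ i j m n, s i m * s j n - s j m * s i n =
      ((del i m * del j n - del i n * del j m : ℤ) : ℝ) := by
    intro i j m n
    have := congrFun (congrFun h (i, j)) (m, n)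
    rw [WM_mul] at this
    exact this
  have hthird : ∀ l m : Fin 8, ∃ k, k ≠ l ∧ k ≠ m := by decide
  have hdiag : ∀ k l, k ≠ l → s k k * s l l - s k l * s k l = 1 := by
    intro k l hkl
    have := hm k l k l
    rw [hsym l k] at this
    rw [this]
    simp [del, hkl]
  have hoff : ∀ k l m, k ≠ l → k ≠ m → l ≠ m → s k k * s l m = s k l * s k m := by
    intro k l m hkl hkm hlm
    have := hm k l k m
    rw [hsym l k] at this
    simp [del, hkm, hlm] at this
    linarith
  have hz : ∀ l m, l ≠ m → s l m = 0 := by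
    intro l m hlm
    obtain ⟨k, hkl, hkm⟩ := hthird l m
    have e1 := hoff k l m hkl hkm hlm
    have e2 := hoff l k m hkl.symm hlm hkm
    rw [hsym l k] at e2
    have e3 := hdiag k l hkl
    have : s l m * (s k k * s l l - s k l * s k l) = 0 := by
      linear_combination s l l * e1 + s k l * e2
    rw [e3, mul_one] at this
    exact this
  have hprod : ∀ k l, k ≠ l → s k k * s l l = 1 := by
    intro k l hkl
    have := hdiag k l hkl
    rw [hz k l hkl] at this
    linarith
  have hone : ∀ k, s k k = 1 := by
    intro k
    obtain ⟨l, hl, -⟩ := hthird k k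
    obtain ⟨m, hmk, hml⟩ := hthird k l
    have e1 := hprod k l hl.symm
    have e2 := hprod k m hmk.symm
    have e3 := hprod l m hml.symm
    have e4 : s k k * s k k = 1 := by
      linear_combination (-(s k k * s k k)) * e3 + s k k * s m m * e1 + e2
    nlinarith [hpos k]
  ext i j
  by_cases hij : i = j
  · subst hij; rw [hone, Matrix.one_apply_eq]
  · rw [hz i j hij, Matrix.one_apply_ne hij]

/-- The matrix of a linear map. -/
def matA (A : E8 →ₗ[ℝ] E8) : Matrix (Fin 8) (Fin 8) ℝ := Matrix.of fun j i => A (bv i) j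

theorem eq_sum_bv (x : E8) : x = ∑ j, x j • bv j := by
  ext n
  simp [bv_apply, del]

theorem matA_pres (A : E8 →ₗ[ℝ] E8)
    (hA : ∀ x y z w : E8, Phi (A x) (A y) (A z) (A w) = Phi x y z w) (I : Fin 4 → Fin 8) :
    ∑ P, pr (matA A) P I * fv P = fv I := by
  have h1 : fv I = PhiAlt (fun m => A (bv (I m))) := by
    rw [fv, PhiAlt_apply, PhiAlt_apply, hA]
  have h2 : (fun m => A (bv (I m))) = fun m => ∑ j, matA A j (I m) • bv j := by
    funext m
    exact eq_sum_bv _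
  have h3 := PhiAlt.toMultilinearMap.map_sum (fun (m : Fin 4) j => matA A j (I m) • bv j)
  have h4 : fv I = ∑ r : Fin 4 → Fin 8, PhiAlt (fun m => matA A (r m) (I m) • bv (r m)) := by
    rw [h1, h2]; exact h3
  rw [h4]
  refine Finset.sum_congr rfl fun r _ => ?_
  have := PhiAlt.toMultilinearMap.map_smul_univ (fun m => matA A (r m) (I m)) (fun m => bv (r m))
  exact this.symm

theorem det_matA (A : E8 →ₗ[ℝ] E8) : LinearMap.det A = (matA A).det := by
  rw [← LinearMap.det_toMatrix (EuclideanSpace.basisFun (Fin 8) ℝ).toBasis]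
  refine congrArg Matrix.det ?_
  ext i j
  simp [LinearMap.toMatrix_apply, matA, bv]

/-- any linear map preserving the Cayley 4-form Φ₀ is a special
orthogonal transformation (Spin(7) ⊂ SO(8)). -/
theorem stabilizer_of_cayley_in_SO8
    (A : E8 →ₗ[ℝ] E8)
    (hA : ∀ x y z w : E8, Phi (A x) (A y) (A z) (A w) = Phi x y z w) :
    (∀ x y : E8, ⟪A x, A y⟫ = ⟪x, y⟫) ∧ LinearMap.det A = 1 := by
  have h := matA_pres A hA
  refine ⟨?_, by rw [det_matA, det_eq_one _ h]⟩
  have hs : (matA A)ᵀ * matA A = 1 := by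
    refine eq_one_of_minors _ ?_ ?_ (minors _ h)
    · intro i j
      simp only [Matrix.mul_apply, Matrix.transpose_apply]
      exact Finset.sum_congr rfl fun k _ => mul_comm _ _
    · intro i
      simp only [Matrix.mul_apply, Matrix.transpose_apply]
      exact Finset.sum_nonneg fun k _ => mul_self_nonneg _
  have hb : ∀ i j, ⟪A (bv i), A (bv j)⟫ = ((1 : Matrix (Fin 8) (Fin 8) ℝ) i j) := by
    intro i j
    rw [← hs, PiLp.inner_apply, Matrix.mul_apply]
    refine Finset.sum_congr rfl fun k _ => ?_
    simp [matA, mul_comm]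
  intro x y
  have hx : A x = ∑ i, x i • A (bv i) := by
    conv_lhs => rw [eq_sum_bv x]
    simp only [map_sum, map_smul]
  have hy : A y = ∑ i, y i • A (bv i) := by
    conv_lhs => rw [eq_sum_bv y]
    simp only [map_sum, map_smul]
  rw [hx, hy, sum_inner]
  simp only [inner_sum, real_inner_smul_left, real_inner_smul_right, hb]
  rw [PiLp.inner_apply]
  simp [Matrix.one_apply, mul_comm]
end
end
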